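/- Let r ≥ 2 be an integer. The Raney numbers R_{(r+1)/2, 1/2}(n) = (1/((r+1)n+1))·binom(((r+1)n+1)/2, n) are the moments of a measure supported in [0, (r+1)^{(r+1)/2}/(2(r−1)^{(r−1)/2})]; in particular, for every n ≥ 0, ∫_0^{x*} x^n · v(x) dx = (1/((r+1)n+1))·binom(((r+1)n+1)/2, n), where x* = (r+1)^{(r+1)/2}/(2(r−1)^{(r−1)/2}) and v is given in the coordinate x = σ(φ) by v(σ(φ)) = sin(2φ)sin(φ)(sin((r−1)φ))^{r/2−1}/(π(sin((r+1)φ))^{r/2}). -/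

import Mathlib

open Real Set Finset intervalIntegral

open Filter Topology

/-- `f` has a primitive on the upper half-plane whose imaginary part tends to `0` at the real
point `x₀` and to `c` at the origin. -/
def HasImPrimitive (x₀ : ℝ) (f : ℂ → ℂ) (c : ℝ) : Prop :=
  ∃ Φ : ℂ → ℂ, (∀ z : ℂ, 0 < z.im → HasDerivAt Φ (f z) z) ∧
    Tendsto (fun z => (Φ z).im) (𝓝[{z : ℂ | 0 < z.im}] (x₀ : ℂ)) (𝓝 0) ∧
    Tendsto (fun z => (Φ z).im) (𝓝[{z : ℂ | 0 < z.im}] 0) (𝓝 c)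

namespace HasImPrimitive

variable {x₀ : ℝ} {f g : ℂ → ℂ} {c d : ℝ}

lemma linear_comb (hf : HasImPrimitive x₀ f c) (hg : HasImPrimitive x₀ g d) (a b : ℝ) :
    HasImPrimitive x₀ (fun z => a * f z + b * g z) (a * c + b * d) := by
  obtain ⟨Φ, h1, h2, h3⟩ := hf
  obtain ⟨Ψ, k1, k2, k3⟩ := hg
  refine ⟨fun z => a * Φ z + b * Ψ z, fun z hz =>
    ((h1 z hz).const_mul _).add ((k1 z hz).const_mul _), ?_, ?_⟩
  · simpa using (h2.const_mul a).add (k2.const_mul b)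
  · simpa using (h3.const_mul a).add (k3.const_mul b)

lemma congr (hf : HasImPrimitive x₀ f c) (h : ∀ z : ℂ, 0 < z.im → f z = g z) :
    HasImPrimitive x₀ g c := by
  obtain ⟨Φ, h1, h2, h3⟩ := hf
  exact ⟨Φ, fun z hz => h z hz ▸ h1 z hz, h2, h3⟩

lemma of_continuousAt {Φ : ℂ → ℂ} (h : ∀ z : ℂ, 0 < z.im → HasDerivAt Φ (f z) z)
    (hx : ContinuousAt Φ x₀) (h0 : ContinuousAt Φ 0) (hx' : (Φ x₀).im = 0)
    (h0' : (Φ 0).im = 0) : HasImPrimitive x₀ f 0 := by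
  refine ⟨Φ, h, ?_, ?_⟩
  · rw [← hx']
    exact (Complex.continuous_im.continuousAt.comp hx).tendsto.mono_left nhdsWithin_le_nhds
  · rw [← h0']
    exact (Complex.continuous_im.continuousAt.comp h0).tendsto.mono_left nhdsWithin_le_nhds

lemma sub_one_ne_zero {z : ℂ} (hz : 0 < z.im) : z - 1 ≠ 0 := by
  intro h
  have := congrArg Complex.im h
  simp at this
  exact hz.ne' this

lemma add_one_ne_zero {z : ℂ} (hz : 0 < z.im) : z + 1 ≠ 0 := by
  intro h
  have := congrArg Complex.im h
  simp at this
  exact hz.ne' this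

lemma sq_sub_one_ne_zero {z : ℂ} (hz : 0 < z.im) : z ^ 2 - 1 ≠ 0 := by
  have : z ^ 2 - 1 = (z - 1) * (z + 1) := by ring
  rw [this]
  exact mul_ne_zero (sub_one_ne_zero hz) (add_one_ne_zero hz)

lemma monomial (M : ℕ) (x₀ : ℝ) : HasImPrimitive x₀ (fun z => z ^ M) 0 := by
  refine of_continuousAt (Φ := fun z => z ^ (M + 1) / ((M + 1 : ℝ) : ℂ)) (fun z _ => ?_)
    (by fun_prop) (by fun_prop) ?_ (by simp)
  · have := (hasDerivAt_pow (M + 1) z).div_const ((M + 1 : ℝ) : ℂ)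
    refine this.congr_deriv ?_
    have : (M : ℂ) + 1 ≠ 0 := by exact_mod_cast M.succ_ne_zero
    push_cast
    field_simp
  · norm_cast

lemma inv_sub_one (hx : 1 < x₀) : HasImPrimitive x₀ (fun z => (z - 1)⁻¹) π := by
  refine ⟨fun z => Complex.log (z - 1), fun z hz => ?_, ?_, ?_⟩
  · have h : z - 1 ∈ Complex.slitPlane := Or.inr (by simpa using hz.ne')
    simpa using ((hasDerivAt_id z).sub_const 1).clog h
  · have h : (x₀ : ℂ) - 1 ∈ Complex.slitPlane := Or.inl (by simpa using hx)
    have hc : ContinuousAt (fun z : ℂ => (Complex.log (z - 1)).im) x₀ :=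
      Complex.continuous_im.continuousAt.comp
        (ContinuousAt.clog (by fun_prop) h)
    have he : (Complex.log ((x₀ : ℂ) - 1)).im = 0 := by
      rw [Complex.log_im, Complex.arg_eq_zero_iff]
      exact ⟨by simpa using hx.le, by simp⟩
    rw [← he]
    exact hc.tendsto.mono_left nhdsWithin_le_nhds
  · have h := Complex.tendsto_log_nhdsWithin_im_nonneg_of_re_neg_of_im_zero
      (z := -1) (by simp) (by simp)
    have h' := (Complex.continuous_im.tendsto _).comp h
    simp only [norm_neg, norm_one, Real.log_one, Complex.ofReal_zero, zero_add, Complex.mul_im,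
      Complex.ofReal_re, Complex.I_im, mul_one, Complex.ofReal_im, Complex.I_re, mul_zero,
      add_zero] at h'
    refine h'.comp (f := fun z : ℂ => z - 1) ?_
    refine tendsto_nhdsWithin_iff.2 ⟨?_, ?_⟩
    · have : ContinuousAt (fun z : ℂ => z - 1) 0 := by fun_prop
      simpa using this.tendsto.mono_left nhdsWithin_le_nhds
    · filter_upwards [self_mem_nhdsWithin] with z hz
      simpa using le_of_lt hz

lemma inv_add_one (hx : 1 < x₀) : HasImPrimitive x₀ (fun z => (z + 1)⁻¹) 0 := by
  refine of_continuousAt (Φ := fun z => Complex.log (z + 1)) (fun z hz => ?_) ?_ ?_ ?_ (by simp)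
  · have h : z + 1 ∈ Complex.slitPlane := Or.inr (by simpa using hz.ne')
    simpa using ((hasDerivAt_id z).add_const 1).clog h
  · exact ContinuousAt.clog (by fun_prop) (Or.inl (by simp; linarith))
  · exact ContinuousAt.clog (by fun_prop) (Or.inl (by simp))
  · rw [Complex.log_im, Complex.arg_eq_zero_iff]
    exact ⟨by simp; linarith, by simp⟩

lemma pow_div_sq_sub_one (hx : 1 < x₀) (M : ℕ) :
    HasImPrimitive x₀ (fun z => z ^ M / (z ^ 2 - 1)) (π / 2) := by
  induction M using Nat.twoStepInduction with
  | zero =>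
    have h := (inv_sub_one hx).linear_comb (inv_add_one hx) (1 / 2) (-1 / 2)
    rw [show (1 / 2 : ℝ) * π + (-1 / 2) * 0 = π / 2 by ring] at h
    refine h.congr fun z hz => ?_
    have h1 := sub_one_ne_zero hz
    have h2 := add_one_ne_zero hz
    rw [show z ^ 2 - 1 = (z - 1) * (z + 1) by ring]
    push_cast
    field_simp
    ring
  | one =>
    have h := (inv_sub_one hx).linear_comb (inv_add_one hx) (1 / 2) (1 / 2)
    rw [show (1 / 2 : ℝ) * π + (1 / 2) * 0 = π / 2 by ring] at h
    refine h.congr fun z hz => ?_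
    have h1 := sub_one_ne_zero hz
    have h2 := add_one_ne_zero hz
    rw [show z ^ 2 - 1 = (z - 1) * (z + 1) by ring]
    push_cast
    field_simp
    ring
  | more M ih _ =>
    have h := ih.linear_comb (monomial M x₀) 1 1
    rw [show (1 : ℝ) * (π / 2) + 1 * 0 = π / 2 by ring] at h
    refine h.congr fun z hz => ?_
    have h1 := sq_sub_one_ne_zero hz
    push_cast
    field_simp
    ring

lemma deriv_pow_div (hx : 1 < x₀) (M k : ℕ) :
    HasImPrimitive x₀ (fun z => (M + 1 : ℝ) * (z ^ M / (z ^ 2 - 1) ^ (k + 1)) -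
      (2 * (k + 1) : ℝ) * (z ^ (M + 2) / (z ^ 2 - 1) ^ (k + 2))) 0 := by
  have hx1 : (x₀ : ℂ) ^ 2 - 1 ≠ 0 := by
    norm_cast
    nlinarith
  refine of_continuousAt (Φ := fun z => z ^ (M + 1) / (z ^ 2 - 1) ^ (k + 1)) (fun z hz => ?_)
    ?_ ?_ ?_ (by simp)
  · have h1 := sq_sub_one_ne_zero hz
    have h := (hasDerivAt_pow (M + 1) z).fun_div
      ((((hasDerivAt_pow 2 z).sub_const 1)).fun_pow (k + 1)) (pow_ne_zero _ h1)
    refine h.congr_deriv ?_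
    push_cast
    field_simp
    ring
  · exact ContinuousAt.div (by fun_prop) (by fun_prop) (pow_ne_zero _ hx1)
  · exact ContinuousAt.div (by fun_prop) (by fun_prop) (by simp)
  · norm_cast

lemma pow_div_pow (hx : 1 < x₀) (k : ℕ) : ∀ M : ℕ, 2 * k ≤ M →
    HasImPrimitive x₀ (fun z => z ^ M / (z ^ 2 - 1) ^ (k + 1))
      (π / 2 * ((∏ j ∈ Finset.range k, (((M : ℝ) - 1) / 2 - j)) / (k.factorial : ℝ))) := by
  induction k with
  | zero => intro M _; simpa using pow_div_sq_sub_one hx M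
  | succ k ih =>
    intro M hM
    obtain ⟨M, rfl⟩ : ∃ N, M = N + 2 := ⟨M - 2, by omega⟩
    have h := (ih M (by omega)).linear_comb (deriv_pow_div hx M k)
      ((M + 1) / (2 * (k + 1))) (-1 / (2 * (k + 1)))
    have hk : (k : ℝ) + 1 ≠ 0 := by positivity
    have hk' : (k : ℂ) + 1 ≠ 0 := by exact_mod_cast k.succ_ne_zero
    have hp : ∏ j ∈ Finset.range (k + 1), ((((M + 2 : ℕ) : ℝ) - 1) / 2 - j) =
        (∏ j ∈ Finset.range k, (((M : ℝ) - 1) / 2 - j)) * ((M + 1) / 2) := by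
      rw [Finset.prod_range_succ']
      congr 1
      · refine Finset.prod_congr rfl fun j _ => ?_
        push_cast
        ring
      · push_cast
        ring
    rw [hp, Nat.factorial_succ]
    convert h.congr (g := fun z => z ^ (M + 2) / (z ^ 2 - 1) ^ (k + 2)) fun z hz => ?_ using 1
    · push_cast
      field_simp
      ring
    · have h1 := sq_sub_one_ne_zero hz
      push_cast
      field_simp
      ring

end HasImPrimitive

lemma integral_eq_sub_of_deriv_nonneg_of_tendsto {f f' : ℝ → ℝ} {a b fa fb : ℝ} (hab : a < b)
    (hderiv : ∀ x ∈ Ioo a b, HasDerivAt f (f' x) x) (hpos : ∀ x ∈ Ioo a b, 0 ≤ f' x)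
    (ha : Tendsto f (𝓝[>] a) (𝓝 fa)) (hb : Tendsto f (𝓝[<] b) (𝓝 fb)) :
    ∫ x in a..b, f' x = fb - fa := by
  refine integral_eq_sub_of_hasDerivAt_of_tendsto hab hderiv ?_ ha hb
  have hcont := continuousOn_Icc_extendFrom_Ioo (f := f)
    (fun x hx => (hderiv x hx).continuousAt.continuousWithinAt) ha hb
  rw [intervalIntegrable_iff_integrableOn_Ioc_of_le hab.le]
  refine integrableOn_deriv_of_nonneg hcont (fun x hx => ?_) hpos
  refine (hderiv x hx).congr_of_eventuallyEq ?_
  filter_upwards [Ioo_mem_nhds hx.1 hx.2] with y hy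
  exact extendFrom_eq (subset_closure hy) (hderiv y hy).continuousAt.continuousWithinAt

lemma sin_sub_one_mul_pos {r : ℕ} (hr : 2 ≤ r) {φ : ℝ} (hφ : φ ∈ Ioo 0 (π / ((r : ℝ) + 1))) :
    0 < Real.sin (((r : ℝ) - 1) * φ) := by
  have hr' : (2 : ℝ) ≤ r := by exact_mod_cast hr
  have h := (lt_div_iff₀ (by positivity)).1 hφ.2
  exact Real.sin_pos_of_pos_of_lt_pi (mul_pos (by linarith) hφ.1) (by nlinarith [hφ.1])

lemma sin_two_mul_pos {r : ℕ} (hr : 2 ≤ r) {φ : ℝ} (hφ : φ ∈ Ioo 0 (π / ((r : ℝ) + 1))) :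
    0 < Real.sin (2 * φ) := by
  have hr' : (2 : ℝ) ≤ r := by exact_mod_cast hr
  have h := (lt_div_iff₀ (by positivity)).1 hφ.2
  exact Real.sin_pos_of_pos_of_lt_pi (mul_pos (by linarith) hφ.1) (by nlinarith [hφ.1])

lemma sin_add_one_mul_pos {r : ℕ} {φ : ℝ} (hφ : φ ∈ Ioo 0 (π / ((r : ℝ) + 1))) :
    0 < Real.sin (((r : ℝ) + 1) * φ) := by
  have h := (lt_div_iff₀ (by positivity)).1 hφ.2
  exact Real.sin_pos_of_pos_of_lt_pi (mul_pos (by positivity) hφ.1) (by nlinarith [hφ.1])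

lemma sin_pos_of_mem_Ioo {r : ℕ} {φ : ℝ} (hφ : φ ∈ Ioo 0 (π / ((r : ℝ) + 1))) :
    0 < Real.sin φ := by
  have h := (lt_div_iff₀ (by positivity)).1 hφ.2
  have hr : (0 : ℝ) ≤ r := by positivity
  exact Real.sin_pos_of_pos_of_lt_pi hφ.1 (by nlinarith [hφ.1])

/-- The parametrization `σ` of the support of the Raney density. -/
noncomputable def raneySigma (r : ℕ) (φ : ℝ) : ℝ :=
  Real.sin (((r : ℝ) + 1) * φ) ^ (((r : ℝ) + 1) / 2) /
    (Real.sin (2 * φ) * Real.sin (((r : ℝ) - 1) * φ) ^ (((r : ℝ) - 1) / 2))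

/-- The modulus of `raneyCurve`. -/
noncomputable def raneyRadius (r : ℕ) (φ : ℝ) : ℝ :=
  √(Real.sin (((r : ℝ) + 1) * φ) / Real.sin (((r : ℝ) - 1) * φ))

/-- The curve in the upper half-plane along which `u ^ (r + 1) / (u ^ 2 - 1)` is real. -/
noncomputable def raneyCurve (r : ℕ) (φ : ℝ) : ℂ :=
  raneyRadius r φ * Complex.exp (φ * Complex.I)

section

variable {r : ℕ} {φ : ℝ}

lemma raneyRadius_pos (hr : 2 ≤ r) (hφ : φ ∈ Ioo 0 (π / ((r : ℝ) + 1))) :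
    0 < raneyRadius r φ :=
  Real.sqrt_pos.2 (div_pos (sin_add_one_mul_pos hφ) (sin_sub_one_mul_pos hr hφ))

lemma raneyCurve_im : (raneyCurve r φ).im = raneyRadius r φ * Real.sin φ := by
  simp [raneyCurve, Complex.exp_ofReal_mul_I_im]

lemma raneyCurve_im_pos (hr : 2 ≤ r) (hφ : φ ∈ Ioo 0 (π / ((r : ℝ) + 1))) :
    0 < (raneyCurve r φ).im := by
  rw [raneyCurve_im]
  exact mul_pos (raneyRadius_pos hr hφ) (sin_pos_of_mem_Ioo hφ)

lemma raneySigma_pos (hr : 2 ≤ r) (hφ : φ ∈ Ioo 0 (π / ((r : ℝ) + 1))) :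
    0 < raneySigma r φ :=
  div_pos (Real.rpow_pos_of_pos (sin_add_one_mul_pos hφ) _)
    (mul_pos (sin_two_mul_pos hr hφ) (Real.rpow_pos_of_pos (sin_sub_one_mul_pos hr hφ) _))

lemma raneyRadius_pow (hr : 2 ≤ r) (hφ : φ ∈ Ioo 0 (π / ((r : ℝ) + 1))) (n : ℕ) :
    raneyRadius r φ ^ n = Real.sin (((r : ℝ) + 1) * φ) ^ ((n : ℝ) / 2) /
      Real.sin (((r : ℝ) - 1) * φ) ^ ((n : ℝ) / 2) := by
  have ha := sin_add_one_mul_pos hφ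
  have hb := sin_sub_one_mul_pos hr hφ
  rw [raneyRadius, Real.sqrt_eq_rpow, ← Real.rpow_natCast, ← Real.rpow_mul (by positivity),
    Real.div_rpow ha.le hb.le, show 1 / 2 * (n : ℝ) = n / 2 by ring]

lemma raneySigma_eq (hr : 2 ≤ r) (hφ : φ ∈ Ioo 0 (π / ((r : ℝ) + 1))) :
    raneySigma r φ = raneyRadius r φ ^ (r + 1) * Real.sin (((r : ℝ) - 1) * φ) /
      Real.sin (2 * φ) := by
  have ha := sin_add_one_mul_pos hφ
  have hb := sin_sub_one_mul_pos hr hφ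
  have ht := sin_two_mul_pos hr hφ
  rw [raneyRadius_pow hr hφ, raneySigma]
  have h : Real.sin (((r : ℝ) - 1) * φ) ^ (((r + 1 : ℕ) : ℝ) / 2) =
      Real.sin (((r : ℝ) - 1) * φ) ^ (((r : ℝ) - 1) / 2) * Real.sin (((r : ℝ) - 1) * φ) := by
    rw [← Real.rpow_add_one hb.ne']
    congr 1
    push_cast
    ring
  rw [h]
  push_cast
  have := Real.rpow_pos_of_pos hb (((r : ℝ) - 1) / 2)
  generalize Real.sin (((r : ℝ) - 1) * φ) = b at *
  field_simp

lemma raney_density_eq (hr : 2 ≤ r) (hφ : φ ∈ Ioo 0 (π / ((r : ℝ) + 1))) :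
    Real.sin (2 * φ) * Real.sin φ * Real.sin (((r : ℝ) - 1) * φ) ^ ((r : ℝ) / 2 - 1) /
      (π * Real.sin (((r : ℝ) + 1) * φ) ^ ((r : ℝ) / 2)) =
    (raneyCurve r φ).im / raneySigma r φ / π := by
  have ha := sin_add_one_mul_pos hφ
  have hb := sin_sub_one_mul_pos hr hφ
  have ht := sin_two_mul_pos hr hφ
  have hq := raneyRadius_pos hr hφ
  rw [raneySigma_eq hr hφ, raneyCurve_im, pow_succ, raneyRadius_pow hr hφ,
    Real.rpow_sub_one hb.ne']
  have := Real.rpow_pos_of_pos hb ((r : ℝ) / 2)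
  have := Real.rpow_pos_of_pos ha ((r : ℝ) / 2)
  field_simp

lemma raneyCurve_sq_sub_one (hr : 2 ≤ r) (hφ : φ ∈ Ioo 0 (π / ((r : ℝ) + 1))) :
    raneyCurve r φ ^ 2 - 1 = (Real.sin (2 * φ) / Real.sin (((r : ℝ) - 1) * φ) : ℝ) *
      Complex.exp ((((r : ℝ) + 1) * φ : ℝ) * Complex.I) := by
  have ha := sin_add_one_mul_pos hφ
  have hb := sin_sub_one_mul_pos hr hφ
  have hs : Complex.exp (φ * Complex.I) ^ 2 = Complex.exp ((2 * φ : ℝ) * Complex.I) := by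
    rw [← Complex.exp_nat_mul]
    congr 1
    push_cast
    ring
  have hq : ((raneyRadius r φ : ℂ)) ^ 2 =
      ((Real.sin (((r : ℝ) + 1) * φ) / Real.sin (((r : ℝ) - 1) * φ) : ℝ) : ℂ) := by
    rw [← Complex.ofReal_pow, raneyRadius, Real.sq_sqrt (by positivity)]
  have hsb : Real.sin (((r : ℝ) - 1) * φ) =
      Real.sin (((r : ℝ) + 1) * φ) * Real.cos (2 * φ) -
        Real.cos (((r : ℝ) + 1) * φ) * Real.sin (2 * φ) := by
    rw [← Real.sin_sub]
    congr 1
    ring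
  rw [raneyCurve, mul_pow, hs, hq]
  clear hq
  generalize Real.sin (((r : ℝ) - 1) * φ) = b at *
  generalize 2 * φ = t at *
  apply Complex.ext
  · simp only [Complex.sub_re, Complex.re_ofReal_mul, Complex.exp_ofReal_mul_I_re, Complex.one_re]
    field_simp
    linear_combination -hsb
  · simp only [Complex.sub_im, Complex.im_ofReal_mul, Complex.exp_ofReal_mul_I_im, Complex.one_im]
    field_simp
    ring

lemma raneySigma_eq_raneyCurve (hr : 2 ≤ r) (hφ : φ ∈ Ioo 0 (π / ((r : ℝ) + 1))) :
    (raneySigma r φ : ℂ) = raneyCurve r φ ^ (r + 1) / (raneyCurve r φ ^ 2 - 1) := by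
  have hb : (Real.sin (((r : ℝ) - 1) * φ) : ℂ) ≠ 0 := by
    exact_mod_cast (sin_sub_one_mul_pos hr hφ).ne'
  have ht : (Real.sin (2 * φ) : ℂ) ≠ 0 := by
    exact_mod_cast (sin_two_mul_pos hr hφ).ne'
  have hs : Complex.exp (φ * Complex.I) ^ (r + 1) =
      Complex.exp ((((r : ℝ) + 1) * φ : ℝ) * Complex.I) := by
    rw [← Complex.exp_nat_mul]
    congr 1
    push_cast
    ring
  rw [raneyCurve_sq_sub_one hr hφ, raneyCurve, mul_pow, hs, raneySigma_eq hr hφ]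
  have he := Complex.exp_ne_zero ((((r : ℝ) + 1) * φ : ℝ) * Complex.I)
  generalize Complex.exp ((((r : ℝ) + 1) * φ : ℝ) * Complex.I) = e at he ⊢
  rw [Complex.ofReal_div, Complex.ofReal_mul, Complex.ofReal_div, Complex.ofReal_pow]
  field_simp

lemma exists_hasDerivAt_raneyCurve (hr : 2 ≤ r) (hφ : φ ∈ Ioo 0 (π / ((r : ℝ) + 1))) :
    ∃ u', HasDerivAt (raneyCurve r) u' φ := by
  have ha := sin_add_one_mul_pos hφ
  have hb := sin_sub_one_mul_pos hr hφ
  have h1 : DifferentiableAt ℝ (raneyRadius r) φ :=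
    DifferentiableAt.sqrt (DifferentiableAt.div (by fun_prop) (by fun_prop) hb.ne')
      (div_pos ha hb).ne'
  have h2 : HasDerivAt (fun φ : ℝ => Complex.exp (φ * Complex.I)) _ φ :=
    ((Complex.ofRealCLM.hasDerivAt (x := φ)).mul_const Complex.I).cexp
  exact ⟨_, h1.hasDerivAt.ofReal_comp.mul h2⟩

lemma exists_hasDerivAt_raneySigma_neg (hr : 2 ≤ r) (hφ : φ ∈ Ioo 0 (π / ((r : ℝ) + 1))) :
    ∃ s' < 0, HasDerivAt (raneySigma r) s' φ := by
  have ha := sin_add_one_mul_pos hφ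
  have hb := sin_sub_one_mul_pos hr hφ
  have ht := sin_two_mul_pos hr hφ
  have hd (c : ℝ) (hc : 0 < Real.sin (c * φ)) : HasDerivAt (fun x => Real.log (Real.sin (c * x)))
      (c * Real.cos (c * φ) / Real.sin (c * φ)) φ := by
    have h := (((hasDerivAt_id φ).const_mul c).sin).log hc.ne'
    refine h.congr_deriv ?_
    simp [mul_comm]
  have hL := ((((hd _ ha).const_mul (((r : ℝ) + 1) / 2)).sub (hd _ ht)).sub
    ((hd _ hb).const_mul (((r : ℝ) - 1) / 2))).exp
  refine ⟨_, ?_, hL.congr_of_eventuallyEq ?_⟩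
  · refine mul_neg_of_pos_of_neg (Real.exp_pos _) ?_
    have hsa : Real.sin (((r : ℝ) + 1) * φ) =
        Real.sin (2 * φ) * Real.cos (((r : ℝ) - 1) * φ) +
          Real.cos (2 * φ) * Real.sin (((r : ℝ) - 1) * φ) := by
      rw [← Real.sin_add]
      congr 1
      ring
    have hca : Real.cos (((r : ℝ) + 1) * φ) =
        Real.cos (2 * φ) * Real.cos (((r : ℝ) - 1) * φ) -
          Real.sin (2 * φ) * Real.sin (((r : ℝ) - 1) * φ) := by
      rw [← Real.cos_add]
      congr 1
      ring
    have key : ((r : ℝ) + 1) / 2 * (((r : ℝ) + 1) * Real.cos (((r : ℝ) + 1) * φ) /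
          Real.sin (((r : ℝ) + 1) * φ)) - 2 * Real.cos (2 * φ) / Real.sin (2 * φ) -
          ((r : ℝ) - 1) / 2 * (((r : ℝ) - 1) * Real.cos (((r : ℝ) - 1) * φ) /
          Real.sin (((r : ℝ) - 1) * φ)) =
        -((2 * Real.cos (2 * φ) * Real.sin (((r : ℝ) - 1) * φ) -
          ((r : ℝ) - 1) * Real.cos (((r : ℝ) - 1) * φ) * Real.sin (2 * φ)) ^ 2 +
          (((r : ℝ) + 1) * Real.sin (2 * φ) * Real.sin (((r : ℝ) - 1) * φ)) ^ 2) /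
        (2 * Real.sin (((r : ℝ) + 1) * φ) * Real.sin (2 * φ) *
          Real.sin (((r : ℝ) - 1) * φ)) := by
      clear hL hd
      generalize Real.sin (((r : ℝ) + 1) * φ) = sa at *
      generalize ((r : ℝ) - 1) * φ = b at *
      generalize 2 * φ = t at *
      rw [hca]
      field_simp
      rw [hsa]
      ring
    rw [key]
    refine div_neg_of_neg_of_pos (neg_neg_of_pos ?_) (by positivity)
    have : 0 < ((r : ℝ) + 1) * Real.sin (2 * φ) * Real.sin (((r : ℝ) - 1) * φ) := by positivity
    positivity
  · filter_upwards [Ioo_mem_nhds hφ.1 hφ.2] with x hx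
    have ha := sin_add_one_mul_pos hx
    have hb := sin_sub_one_mul_pos hr hx
    have ht := sin_two_mul_pos hr hx
    simp only [Pi.sub_apply]
    rw [raneySigma, Real.exp_sub, Real.exp_sub, Real.exp_log ht, Real.rpow_def_of_pos ha,
      Real.rpow_def_of_pos hb, div_div, mul_comm (Real.log _), mul_comm (Real.log _)]

/-- Since `σ` is real, the moment integrand is the imaginary part of a rational form on the
curve. -/
lemma raneyCurve_im_mul_deriv (hr : 2 ≤ r) (hφ : φ ∈ Ioo 0 (π / ((r : ℝ) + 1))) (n : ℕ)
    {u' : ℂ} {s' : ℝ} (hu : HasDerivAt (raneyCurve r) u' φ)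
    (hs : HasDerivAt (raneySigma r) s' φ) :
    ((((2 : ℝ) : ℂ) * (raneyCurve r φ ^ ((r + 1) * n + 2) / (raneyCurve r φ ^ 2 - 1) ^ (n + 1)) +
      ((-(r + 1) : ℝ) : ℂ) * (raneyCurve r φ ^ ((r + 1) * n) / (raneyCurve r φ ^ 2 - 1) ^ n)) *
        u').im = raneySigma r φ ^ n * ((raneyCurve r φ).im / raneySigma r φ) * (-s') := by
  have him := raneyCurve_im_pos hr hφ
  have h1 := HasImPrimitive.sq_sub_one_ne_zero him
  have hu0 : raneyCurve r φ ≠ 0 := fun h => by simp [h] at him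
  have hS := raneySigma_eq_raneyCurve hr hφ
  have hd := (hu.fun_pow (r + 1)).fun_div ((hu.fun_pow 2).sub_const 1) h1
  have hd' := hd.congr_of_eventuallyEq (f₁ := fun x => (raneySigma r x : ℂ)) (by
    filter_upwards [Ioo_mem_nhds hφ.1 hφ.2] with x hx using raneySigma_eq_raneyCurve hr hx)
  have he := hs.ofReal_comp.unique hd'
  have hfin : (((2 : ℝ) : ℂ) * (raneyCurve r φ ^ ((r + 1) * n + 2) /
      (raneyCurve r φ ^ 2 - 1) ^ (n + 1)) + ((-(r + 1) : ℝ) : ℂ) *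
      (raneyCurve r φ ^ ((r + 1) * n) / (raneyCurve r φ ^ 2 - 1) ^ n)) * u' =
      ((raneySigma r φ ^ n / raneySigma r φ * (-s') : ℝ) : ℂ) * raneyCurve r φ := by
    push_cast
    rw [he, hS, div_pow, pow_add, pow_mul]
    generalize raneyCurve r φ ^ 2 - 1 = w at *
    generalize raneyCurve r φ = u at *
    push_cast
    field_simp
    ring
  rw [hfin, Complex.im_ofReal_mul]
  ring

lemma tendsto_raneyCurve_left (hr : 2 ≤ r) :
    Tendsto (raneyCurve r) (𝓝[>] 0)
      (𝓝[{z : ℂ | 0 < z.im}] ((√(((r : ℝ) + 1) / ((r : ℝ) - 1)) : ℝ) : ℂ)) := by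
  have hr' : (2 : ℝ) ≤ r := by exact_mod_cast hr
  have hlim (c : ℝ) : Tendsto (fun x => x⁻¹ * Real.sin (c * x)) (𝓝[>] 0) (𝓝 c) := by
    have h : HasDerivAt (fun x => Real.sin (c * x)) c 0 := by
      simpa using ((hasDerivAt_id (0 : ℝ)).const_mul c).sin
    simpa using h.tendsto_slope_zero_right
  refine tendsto_nhdsWithin_iff.2 ⟨?_, ?_⟩
  · have h1 : Tendsto (raneyRadius r) (𝓝[>] 0) (𝓝 √(((r : ℝ) + 1) / ((r : ℝ) - 1))) := by
      refine (((hlim ((r : ℝ) + 1)).div (hlim ((r : ℝ) - 1)) (by linarith)).sqrt).congr' ?_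
      filter_upwards [self_mem_nhdsWithin] with x hx
      have hx : 0 < x := hx
      simp only [Pi.div_apply]
      rw [mul_div_mul_left _ _ (inv_pos.2 hx).ne', raneyRadius]
    have h2 : ContinuousAt (fun φ : ℝ => Complex.exp (φ * Complex.I)) 0 := by fun_prop
    have h3 := ((Complex.continuous_ofReal.tendsto _).comp h1).mul
      (h2.tendsto.mono_left (nhdsWithin_le_nhds (s := Ioi 0)))
    simp only [Complex.ofReal_zero, zero_mul, Complex.exp_zero, mul_one] at h3
    exact h3
  · filter_upwards [Ioo_mem_nhdsGT (show (0 : ℝ) < π / ((r : ℝ) + 1) by positivity)] with x hx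
    exact raneyCurve_im_pos hr hx

lemma tendsto_raneyCurve_right (hr : 2 ≤ r) :
    Tendsto (raneyCurve r) (𝓝[<] (π / ((r : ℝ) + 1))) (𝓝[{z : ℂ | 0 < z.im}] 0) := by
  have hr' : (2 : ℝ) ≤ r := by exact_mod_cast hr
  have hpos : 0 < π / ((r : ℝ) + 1) := by positivity
  refine tendsto_nhdsWithin_iff.2 ⟨?_, ?_⟩
  · have hb : 0 < Real.sin (((r : ℝ) - 1) * (π / ((r : ℝ) + 1))) := by
      refine Real.sin_pos_of_pos_of_lt_pi (mul_pos (by linarith) hpos) ?_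
      rw [← mul_div_assoc, div_lt_iff₀ (by positivity)]
      nlinarith [Real.pi_pos]
    have h1 : ContinuousAt (raneyRadius r) (π / ((r : ℝ) + 1)) :=
      ContinuousAt.sqrt (f := fun φ => Real.sin (((r : ℝ) + 1) * φ) /
        Real.sin (((r : ℝ) - 1) * φ)) (ContinuousAt.div₀ (by fun_prop) (by fun_prop) hb.ne')
    have h0 : raneyRadius r (π / ((r : ℝ) + 1)) = 0 := by
      rw [raneyRadius, mul_div_cancel₀ _ (by positivity)]
      simp
    have h2 : ContinuousAt (raneyCurve r) (π / ((r : ℝ) + 1)) :=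
      (Complex.continuous_ofReal.continuousAt.comp h1).mul (by fun_prop)
    have h3 := h2.tendsto.mono_left (nhdsWithin_le_nhds (s := Iio (π / ((r : ℝ) + 1))))
    simpa [raneyCurve, h0] using h3
  · filter_upwards [Ioo_mem_nhdsLT hpos] with x hx
    exact raneyCurve_im_pos hr hx

end

lemma hasImPrimitive_raney {x₀ : ℝ} (hx : 1 < x₀) {r : ℕ} (hr : 2 ≤ r) (n : ℕ) :
    HasImPrimitive x₀ (fun z => ((2 : ℝ) : ℂ) * (z ^ ((r + 1) * n + 2) / (z ^ 2 - 1) ^ (n + 1)) +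
      ((-(r + 1) : ℝ) : ℂ) * (z ^ ((r + 1) * n) / (z ^ 2 - 1) ^ n))
      (π * ((1 / (((r : ℝ) + 1) * n + 1)) *
        ((∏ j ∈ Finset.range n, ((((r : ℝ) + 1) * n + 1) / 2 - j)) / (n.factorial : ℝ)))) := by
  cases n with
  | zero =>
    have h := (HasImPrimitive.pow_div_pow hx 0 2 (by norm_num)).linear_comb
      (HasImPrimitive.monomial 0 x₀) 2 (-(r + 1))
    convert h.congr fun z _ => ?_ using 1
    · simp
      ring
    · simp
  | succ n =>
    have hM : 3 * (n + 1) ≤ (r + 1) * (n + 1) := Nat.mul_le_mul_right _ (by omega)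
    have h := (HasImPrimitive.pow_div_pow hx (n + 1) ((r + 1) * (n + 1) + 2)
      (by omega)).linear_comb
      (HasImPrimitive.pow_div_pow hx n ((r + 1) * (n + 1)) (by omega)) 2 (-(r + 1))
    convert h using 1
    have hp (x : ℝ) : ∏ j ∈ Finset.range (n + 1), ((x + 1) / 2 - j) =
        (∏ j ∈ Finset.range n, ((x - 1) / 2 - j)) * ((x + 1) / 2) := by
      rw [Finset.prod_range_succ']
      congr 1
      · refine Finset.prod_congr rfl fun j _ => ?_
        push_cast
        ring
      · push_cast
        ring
    push_cast
    rw [show ((r : ℝ) + 1) * (n + 1) + 2 - 1 = ((r : ℝ) + 1) * (n + 1) + 1 by ring,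
      hp, Nat.factorial_succ]
    push_cast
    field_simp
    ring

/-- the moments of the Raney density `v` (written in the coordinate
`x = σ(φ)`, so that `∫_0^{x*} x^n v(x) dx = ∫_0^{π/(r+1)} σ(φ)^n v(σ(φ)) |σ'(φ)| dφ`)
are the Raney numbers `R_{(r+1)/2,1/2}(n) = (1/((r+1)n+1))·binom(((r+1)n+1)/2, n)`. -/
theorem raney_moments (r : ℕ) (hr : 2 ≤ r)
    (σ : ℝ → ℝ)
    (hσ : ∀ φ, σ φ =
      Real.sin (((r : ℝ) + 1) * φ) ^ (((r : ℝ) + 1) / 2) /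
        (Real.sin (2 * φ) * Real.sin (((r : ℝ) - 1) * φ) ^ (((r : ℝ) - 1) / 2))) :
    ∀ n : ℕ,
      ∫ φ in (0 : ℝ)..(π / (r + 1)),
        σ φ ^ n *
          (Real.sin (2 * φ) * Real.sin φ *
              Real.sin (((r : ℝ) - 1) * φ) ^ ((r : ℝ) / 2 - 1) /
            (π * Real.sin (((r : ℝ) + 1) * φ) ^ ((r : ℝ) / 2))) *
          |deriv σ φ| =
      (1 / (((r : ℝ) + 1) * n + 1)) *
        ((∏ j ∈ Finset.range n, ((((r : ℝ) + 1) * n + 1) / 2 - j)) / (n.factorial : ℝ)) := by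
  intro n
  obtain rfl : σ = raneySigma r := funext hσ
  have hr' : (2 : ℝ) ≤ r := by exact_mod_cast hr
  have hx : 1 < √(((r : ℝ) + 1) / ((r : ℝ) - 1)) := by
    rw [Real.lt_sqrt zero_le_one, one_pow, one_lt_div (by linarith)]
    linarith
  obtain ⟨Φ, hΦ, hΦl, hΦr⟩ := hasImPrimitive_raney hx hr n
  have hl := (hΦl.comp (tendsto_raneyCurve_left hr)).div_const π
  have hu := (hΦr.comp (tendsto_raneyCurve_right hr)).div_const π
  rw [integral_eq_sub_of_deriv_nonneg_of_tendsto (by positivity) (fun φ hφ => ?_)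
    (fun φ hφ => ?_) hl hu]
  · rw [mul_div_cancel_left₀ _ Real.pi_ne_zero, zero_div, sub_zero]
  · obtain ⟨u', hu⟩ := exists_hasDerivAt_raneyCurve hr hφ
    obtain ⟨s', hs', hs⟩ := exists_hasDerivAt_raneySigma_neg hr hφ
    have h := (Complex.imCLM.hasFDerivAt.comp_hasDerivAt φ
      ((hΦ _ (raneyCurve_im_pos hr hφ)).comp φ hu)).div_const π
    refine h.congr_deriv ?_
    rw [hs.deriv, abs_of_neg hs', raney_density_eq hr hφ, Complex.imCLM_apply,
      raneyCurve_im_mul_deriv hr hφ n hu hs]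
    ring
  · rw [raney_density_eq hr hφ]
    have := raneySigma_pos hr hφ
    have := raneyCurve_im_pos hr hφ
    positivity
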